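/- arXiv:1201.4439 — 2 statements merged into one kernel-verified Lean document; each statement's English description precedes it below -/
import Mathlib

section
/- The order relation < on ℚ is not definable from the cyclic order relation c, i.e. it is not the case that c ≽ <. -/
open FirstOrder Language

/-- Language with relation symbols indexed by `ι`, where symbol `i` has arity `ar i`. -/
def multiRelLang {ι : Type} (ar : ι → ℕ) : FirstOrder.Language where
  Functions _ := Empty
  Relations m := { i : ι // ar i = m }

/-- The structure on `M` interpreting symbol `i` as the relation `Rels i`. -/
def multiRelStructure {M : Type*} {ι : Type} {ar : ι → ℕ}
    (Rels : ∀ i, (Fin (ar i) → M) → Prop) : (multiRelLang ar).Structure M where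
  funMap f := f.elim
  RelMap r x := Rels r.1 fun j => x (Fin.cast r.2 j)

/-- Language with one relation symbol, of arity `n`. -/
def relLang (n : ℕ) : FirstOrder.Language := multiRelLang (fun _ : Unit => n)

/-- `R` is definable, without parameters, by a first-order formula in the language with a
single relation symbol interpreted as `Q`. -/
def DefinableBy {M : Type*} {n k : ℕ} (Q : (Fin n → M) → Prop)
    (R : (Fin k → M) → Prop) : Prop :=
  letI : (relLang n).Structure M := multiRelStructure (fun _ : Unit => Q)
  ∃ φ : (relLang n).Formula (Fin k), ∀ v : Fin k → M, R v ↔ φ.Realize v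

/-- The order relation on `ℚ`, as a binary relation on tuples. -/
def ltRel : (Fin 2 → ℚ) → Prop := fun v => v 0 < v 1

/-- The betweenness relation `b` on `ℚ`. -/
def bRel : (Fin 3 → ℚ) → Prop := fun v =>
  (v 0 < v 1 ∧ v 1 < v 2) ∨ (v 2 < v 1 ∧ v 1 < v 0)

/-- The cyclic order relation `c` on `ℚ`. -/
def cRel : (Fin 3 → ℚ) → Prop := fun v =>
  (v 0 < v 1 ∧ v 1 < v 2) ∨ (v 1 < v 2 ∧ v 2 < v 0) ∨ (v 2 < v 0 ∧ v 0 < v 1)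

/-- The separation relation `s` on `ℚ`. -/
def sRel : (Fin 4 → ℚ) → Prop := fun v =>
  (cRel ![v 0, v 1, v 2] ∧ cRel ![v 2, v 3, v 0]) ∨
  (cRel ![v 2, v 1, v 0] ∧ cRel ![v 0, v 3, v 2])

/-- The cyclic order of a linear order. -/
def cyc {α : Type*} [LT α] (x y z : α) : Prop :=
  (x < y ∧ y < z) ∨ (y < z ∧ z < x) ∨ (z < x ∧ x < y)

/-- Exchanging the two summands of a lexicographic sum of linear orders is a rotation, so it
preserves the cyclic order. -/
theorem cyc_swap_iff {α β : Type*} [LinearOrder α] [LinearOrder β] (x y z : α ⊕ β) :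
    cyc (toLex x.swap) (toLex y.swap) (toLex z.swap) ↔ cyc (toLex x) (toLex y) (toLex z) := by
  rcases x with x | x <;> rcases y with y | y <;> rcases z with z | z <;>
    simp [cyc]

/-- Some permutation of `ℚ` preserves the cyclic order and exchanges two points `x < y`. -/
theorem exists_cyc_equiv_exchanging : ∃ σ : ℚ ≃ ℚ,
    (∀ x y z, cyc (σ x) (σ y) (σ z) ↔ cyc x y z) ∧ ∃ x y, x < y ∧ σ x = y ∧ σ y = x := by
  have : Countable (ℚ ⊕ₗ ℚ) := inferInstanceAs (Countable (ℚ ⊕ ℚ))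
  obtain ⟨e⟩ := Order.iso_of_countable_dense ℚ (ℚ ⊕ₗ ℚ)
  have cyc_symm (a b c : ℚ ⊕ₗ ℚ) : cyc (e.symm a) (e.symm b) (e.symm c) ↔ cyc a b c := by
    simp [cyc]
  have cyc_e (a b c : ℚ) : cyc (e a) (e b) (e c) ↔ cyc a b c := by
    simp [cyc]
  refine ⟨e.toEquiv.trans ((ofLex.trans ((Equiv.sumComm ℚ ℚ).trans toLex)).trans e.symm.toEquiv),
    fun x y z => ?_, e.symm (toLex (Sum.inl 0)), e.symm (toLex (Sum.inr 0)), ?_, ?_, ?_⟩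
  · exact (cyc_symm _ _ _).trans <|
      (cyc_swap_iff (ofLex (e x)) (ofLex (e y)) (ofLex (e z))).trans (cyc_e x y z)
  · exact e.symm.lt_iff_lt.2 (Sum.Lex.inl_lt_inr _ _)
  · simp
  · simp

/-- A relation definable from `Q` is invariant under every permutation that preserves `Q`. -/
theorem DefinableBy.invariant {M : Type*} {n k : ℕ} {Q : (Fin n → M) → Prop}
    {R : (Fin k → M) → Prop} (h : DefinableBy Q R) (σ : M ≃ M)
    (hσ : ∀ v, Q (σ ∘ v) ↔ Q v) (v : Fin k → M) : R (σ ∘ v) ↔ R v := by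
  let _ : (relLang n).Structure M := multiRelStructure (fun _ : Unit => Q)
  obtain ⟨φ, hφ⟩ := h
  let g : M ≃[relLang n] M :=
    { σ with
      map_fun' := fun f => f.elim
      map_rel' := fun r x => hσ fun j => x (Fin.cast r.2 j) }
  rw [hφ, hφ]
  exact StrongHomClass.realize_formula g φ

/-- The order relation `<` on `ℚ` is not definable from the cyclic order relation `c`. -/
theorem lt_not_definable_from_cyclic : ¬ DefinableBy cRel ltRel := by
  intro h
  obtain ⟨σ, hσ, x, y, hxy, hx, hy⟩ := exists_cyc_equiv_exchanging
  have key := h.invariant σ (fun v => hσ (v 0) (v 1) (v 2)) ![x, y]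
  have hyx : y < x := by simpa [ltRel, hx, hy, hxy] using key
  exact hxy.asymm hyx
end

section
/- Let R be an n-ary relation on ℚ such that b ≽ R and c ≽ R (R is definable both from the betweenness relation b alone and from the cyclic order relation c alone). Then either s ≈ R (R and the separation relation s define each other), or R is definable without parameters by a first-order formula in the pure language of equality (i.e. R is preserved by every permutation of ℚ). -/
open FirstOrder Language

/-- `R` is definable, without parameters, by a first-order formula in the pure language of
equality (the empty language). -/
def EqDefinable {M : Type*} {k : ℕ} (R : (Fin k → M) → Prop) : Prop :=
  letI : Language.empty.Structure M := Language.emptyStructure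
  ∃ φ : Language.empty.Formula (Fin k), ∀ v : Fin k → M, R v ↔ φ.Realize v

/-! Types over the empty set and definability. -/

/-- Two tuples have the same type if they belong to the same `∅`-definable sets. -/
def SameType (L : FirstOrder.Language) {M : Type} [L.Structure M] {α : Type}
    (x y : α → M) : Prop :=
  ∀ S : Set (α → M), (∅ : Set M).Definable L S → (x ∈ S ↔ y ∈ S)

namespace SameType

variable {L : FirstOrder.Language} {M : Type} [L.Structure M] {α β : Type} {x y z : α → M}

theorem rfl : SameType L x x := fun _ _ => Iff.rfl

theorem symm (h : SameType L x y) : SameType L y x := fun S hS => (h S hS).symm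

theorem trans (h : SameType L x y) (h' : SameType L y z) : SameType L x z :=
  fun S hS => (h S hS).trans (h' S hS)

theorem comp (h : SameType L x y) (f : β → α) : SameType L (x ∘ f) (y ∘ f) :=
  fun _ hS => h _ (hS.preimage_comp f)

theorem comp_equiv_iff (e : β ≃ α) : SameType L (x ∘ e) (y ∘ e) ↔ SameType L x y := by
  refine ⟨fun h => ?_, fun h => h.comp e⟩
  simpa [Function.comp_assoc] using h.comp e.symm

end SameType

theorem definable_setOf_eq (L : FirstOrder.Language) {M : Type} [L.Structure M] {α : Type}
    (i j : α) : (∅ : Set M).Definable L {v : α → M | v i = v j} :=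
  Set.empty_definable_iff.2
    ⟨Term.equal (Term.var i) (Term.var j), by ext v; simp [Formula.realize_equal]⟩

theorem SameType.apply_eq_iff {L : FirstOrder.Language} {M : Type} [L.Structure M] {α : Type}
    {x y : α → M} (h : SameType L x y) (i j : α) : x i = x j ↔ y i = y j :=
  h _ (definable_setOf_eq L i j)

/-- A set that is a union of classes cut out by finitely many definable sets is definable. -/
theorem definable_of_finite_family {L : FirstOrder.Language} {M : Type} [L.Structure M]
    {α κ : Type} [Finite κ] (D : κ → Set (α → M)) (hD : ∀ k, (∅ : Set M).Definable L (D k))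
    {S : Set (α → M)} (hS : ∀ x y, (∀ k, x ∈ D k ↔ y ∈ D k) → x ∈ S → y ∈ S) :
    (∅ : Set M).Definable L S := by
  classical
  let C : Set κ → Set (α → M) := fun c =>
    if ∃ x ∈ S, ∀ k, x ∈ D k ↔ k ∈ c then ⋂ k, if k ∈ c then D k else (D k)ᶜ else ∅
  have hSC : S = ⋃ c, C c := by
    ext y
    simp only [Set.mem_iUnion, C]
    constructor
    · intro hy
      refine ⟨{k | y ∈ D k}, ?_⟩
      rw [if_pos ⟨y, hy, fun k => Iff.rfl⟩]
      refine Set.mem_iInter.2 fun k => ?_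
      by_cases hk : y ∈ D k <;> simp [hk]
    · rintro ⟨c, hc⟩
      split_ifs at hc with h
      · obtain ⟨x, hx, hxc⟩ := h
        refine hS x y (fun k => ?_) hx
        have := Set.mem_iInter.1 hc k
        rw [hxc]
        split_ifs at this with hk
        · exact ⟨fun _ => this, fun _ => hk⟩
        · exact ⟨fun h => absurd h hk, fun h => absurd h this⟩
      · exact absurd hc (Set.notMem_empty y)
  rw [hSC]
  refine Set.definable_iUnion_of_finite fun c => ?_
  simp only [C]
  split_ifs
  · refine Set.definable_iInter_of_finite fun k => ?_
    split_ifs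
    · exact hD k
    · exact (hD k).compl
  · exact Set.definable_empty

/-- If there are only finitely many types of tuples, every union of types is definable. -/
theorem definable_of_sameType_invariant {L : FirstOrder.Language} {M : Type} [L.Structure M]
    {α κ : Type} [Finite κ] (code : (α → M) → κ)
    (hcode : ∀ x y : α → M, code x = code y → SameType L x y)
    {S : Set (α → M)} (hS : ∀ x y, SameType L x y → x ∈ S → y ∈ S) :
    (∅ : Set M).Definable L S := by
  classical
  have hsep : ∀ p : κ × κ, ∃ D : Set (α → M), (∅ : Set M).Definable L D ∧
      ∀ x y, code x = p.1 → code y = p.2 → ¬ SameType L x y → ¬ (x ∈ D ↔ y ∈ D) := by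
    rintro ⟨c, d⟩
    by_cases h : ∃ x y, code x = c ∧ code y = d ∧ ¬ SameType L x y
    · obtain ⟨x, y, hx, hy, hxy⟩ := h
      have hxy' := hxy
      simp only [SameType, not_forall] at hxy'
      obtain ⟨D, hD, hne⟩ := hxy'
      refine ⟨D, hD, fun x' y' hx' hy' _ => ?_⟩
      rwa [← hcode x x' (hx.trans hx'.symm) D hD, ← hcode y y' (hy.trans hy'.symm) D hD]
    · push Not at h
      exact ⟨∅, Set.definable_empty, fun x y hx hy hxy => absurd (h x y hx hy) hxy⟩
  choose D hD hDsep using hsep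
  refine definable_of_finite_family D hD fun x y hxy => hS x y ?_
  by_contra hne
  exact hDsep (code x, code y) x y _root_.rfl _root_.rfl hne (hxy _)

/-- If there are only finitely many types of tuples indexed by `β`, a partial map preserving types
extends to any tuple indexed by `β`. -/
theorem SameType.exists_extension {L : FirstOrder.Language} {M : Type} [L.Structure M]
    {α β κ : Type} [Finite α] [Finite β] [Finite κ] (code : (β → M) → κ)
    (hcode : ∀ x y : β → M, code x = code y → SameType L x y) (f : α → β) (x : β → M)
    {y : α → M} (h : SameType L (x ∘ f) y) : ∃ z : β → M, z ∘ f = y ∧ SameType L x z := by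
  have hT : (∅ : Set M).Definable L {z | SameType L x z} :=
    definable_of_sameType_invariant code hcode fun u v huv hu => SameType.trans hu huv
  obtain ⟨z, hz, hzy⟩ := (h _ (hT.image_comp f)).1 ⟨x, SameType.rfl, _root_.rfl⟩
  exact ⟨z, hzy, hz⟩

/-- A back-and-forth system that respects `Q` respects all formulas in `Q`. -/
theorem realize_iff_of_backAndForth {n : ℕ} {M : Type} (Q : (Fin n → M) → Prop)
    (E : ∀ β : Type, (β → M) → (β → M) → Prop)
    (symm : ∀ (β : Type) (x y : β → M), E β x y → E β y x)
    (comp : ∀ (β γ : Type) (f : γ → β) (x y : β → M), E β x y → E γ (x ∘ f) (y ∘ f))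
    (apply_eq : ∀ (β : Type) (x y : β → M), E β x y → ∀ i j, x i = x j → y i = y j)
    (rel : ∀ x y, E (Fin n) x y → (Q x ↔ Q y))
    (forth : ∀ (β : Type) [Finite β] (x y : β → M), E β x y → ∀ a, ∃ b,
      E (Option β) (fun o => o.elim a x) (fun o => o.elim b y))
    {α : Type} [Finite α] {k : ℕ} (φ : (relLang n).BoundedFormula α k)
    (v w : α → M) (xs ys : Fin k → M) (h : E (α ⊕ Fin k) (Sum.elim v xs) (Sum.elim w ys)) :
    letI : (relLang n).Structure M := multiRelStructure (fun _ : Unit => Q)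
    (φ.Realize v xs ↔ φ.Realize w ys) := by
  let _ : (relLang n).Structure M := multiRelStructure (fun _ : Unit => Q)
  have hterm : ∀ {k : ℕ} (t : (relLang n).Term (α ⊕ Fin k)), ∃ i, t = Term.var i := by
    rintro k (i | ⟨f, _⟩)
    · exact ⟨i, rfl⟩
    · exact f.elim
  change φ.Realize v xs ↔ φ.Realize w ys
  induction φ with
  | falsum => exact Iff.rfl
  | equal t₁ t₂ =>
    obtain ⟨i, rfl⟩ := hterm t₁
    obtain ⟨j, rfl⟩ := hterm t₂
    exact ⟨apply_eq _ _ _ h i j, apply_eq _ _ _ (symm _ _ _ h) i j⟩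
  | rel R ts =>
    choose i hi using fun j => hterm (ts j)
    obtain rfl : ts = fun j => Term.var (i j) := funext hi
    obtain ⟨u, rfl⟩ := R
    exact rel _ _ (comp _ _ i _ _ h)
  | imp f g ihf ihg => exact imp_congr (ihf _ _ h) (ihg _ _ h)
  | @all k f ih =>
    have key : ∀ (v w : α → M) (xs ys : Fin k → M),
        E (α ⊕ Fin k) (Sum.elim v xs) (Sum.elim w ys) → ∀ a, ∃ b,
        E (α ⊕ Fin (k + 1)) (Sum.elim v (Fin.snoc xs a)) (Sum.elim w (Fin.snoc ys b)) := by
      intro v w xs ys h a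
      obtain ⟨b, hb⟩ := forth _ _ _ h a
      refine ⟨b, ?_⟩
      let g : α ⊕ Fin (k + 1) → Option (α ⊕ Fin k) :=
        Sum.elim (fun i => some (Sum.inl i)) (Fin.snoc (fun i => some (Sum.inr i)) none)
      have hg : ∀ (v : α → M) (xs : Fin k → M) (a : M),
          Sum.elim v (Fin.snoc xs a : Fin (k + 1) → M) =
            (fun o : Option (α ⊕ Fin k) => o.elim a (Sum.elim v xs)) ∘ g := by
        intro v xs a
        funext i
        rcases i with i | i
        · rfl
        · refine Fin.lastCases ?_ (fun i => ?_) i <;> simp [g]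
      rw [hg, hg]
      exact comp _ _ g _ _ hb
    constructor
    · intro hf b
      obtain ⟨a, ha⟩ := key _ _ _ _ (symm _ _ _ h) b
      exact (ih _ _ (symm _ _ _ ha)).1 (hf a)
    · intro hf a
      obtain ⟨b, hb⟩ := key _ _ _ _ h a
      exact (ih _ _ hb).2 (hf b)

/-! Order isomorphic tuples, rotations and reflections. -/

/-- `u` has the order type obtained from `v` by moving the entries in the final segment `U` below
all the others. -/
def IsRotation (U : Set ℚ) {β : Type} (v u : β → ℚ) : Prop :=
  ∀ i j, u i < u j ↔ (v i ∈ U ∧ v j ∉ U) ∨ (v i < v j ∧ (v i ∈ U ↔ v j ∈ U))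

theorem eq_iff_eq_of_lt_iff_lt {β : Type} {x y : β → ℚ} (h : ∀ i j, x i < x j ↔ y i < y j)
    (i j : β) : x i = x j ↔ y i = y j := by
  have h1 := h i j
  have h2 := h j i
  grind

theorem exists_isRotation_Ici (t : ℚ) {β : Type} (v : β → ℚ) :
    ∃ u : β → ℚ, IsRotation (Set.Ici t) v u := by
  refine ⟨fun i => if t ≤ v i then -(v i - t + 1)⁻¹ else (t - v i)⁻¹, fun i j => ?_⟩
  simp only [Set.mem_Ici]
  by_cases hi : t ≤ v i <;> by_cases hj : t ≤ v j
  · have h1 : 0 < v i - t + 1 := by linarith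
    have h2 : 0 < v j - t + 1 := by linarith
    simp only [hi, hj, if_true, neg_lt_neg_iff, inv_lt_inv₀ h2 h1]
    simp
  · have h1 : 0 < (v i - t + 1)⁻¹ := inv_pos.2 (by linarith)
    have h2 : 0 < (t - v j)⁻¹ := inv_pos.2 (by linarith)
    simp only [hi, hj, if_true, if_false]
    simp only [not_false_eq_true, and_self, true_or, iff_true]
    linarith
  · have h1 : 0 < (t - v i)⁻¹ := inv_pos.2 (by linarith)
    have h2 : 0 < (v j - t + 1)⁻¹ := inv_pos.2 (by linarith)
    simp only [hi, hj, if_true, if_false]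
    simp only [false_and, iff_true, and_false, or_self, iff_false, not_lt]
    linarith
  · have h1 : 0 < t - v i := by linarith
    have h2 : 0 < t - v j := by linarith
    simp only [hi, hj, if_false, inv_lt_inv₀ h1 h2]
    simp

theorem IsRotation.cRel_iff {U : Set ℚ} (hU : IsUpperSet U) {β : Type} {v u : β → ℚ}
    (h : IsRotation U v u) (i j k : β) :
    cRel ![u i, u j, u k] ↔ cRel ![v i, v j, v k] := by
  have up : ∀ a b, v a ≤ v b → v a ∈ U → v b ∈ U := fun a b hab => hU hab
  simp only [cRel, Matrix.cons_val_zero, Matrix.cons_val_one, Matrix.cons_val]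
  rw [h i j, h j k, h k i]
  have hij := up i j
  have hji := up j i
  have hjk := up j k
  have hkj := up k j
  have hik := up i k
  have hki := up k i
  clear h up hU
  generalize (v i ∈ U) = p at *
  generalize (v j ∈ U) = q at *
  generalize (v k ∈ U) = r at *
  grind

theorem sRel_congr {v u : Fin 4 → ℚ}
    (h : ∀ i j k, cRel ![u i, u j, u k] ↔ cRel ![v i, v j, v k]) : sRel u ↔ sRel v := by
  simp only [sRel, h]

theorem sRel_congr_anti {v u : Fin 4 → ℚ}
    (h : ∀ i j k, cRel ![u i, u j, u k] ↔ cRel ![v k, v j, v i]) : sRel u ↔ sRel v := by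
  simp only [sRel, h]
  tauto

theorem IsRotation.sRel_iff {U : Set ℚ} (hU : IsUpperSet U) {v u : Fin 4 → ℚ}
    (h : IsRotation U v u) : sRel u ↔ sRel v :=
  sRel_congr (h.cRel_iff hU)

theorem sRel_iff_of_lt_iff_lt {v u : Fin 4 → ℚ} (h : ∀ i j, u i < u j ↔ v i < v j) :
    sRel u ↔ sRel v :=
  sRel_congr fun i j k => by simp [cRel, h]

theorem sRel_iff_of_lt_iff_gt {v u : Fin 4 → ℚ} (h : ∀ i j, u i < u j ↔ v j < v i) :
    sRel u ↔ sRel v :=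
  sRel_congr_anti fun i j k => by simp only [cRel, Matrix.cons_val, h]; tauto

/-- A structure on `ℚ` whose types are invariant under order isomorphisms, rotations and
reflections. -/
structure IsCircular (L : FirstOrder.Language) [L.Structure ℚ] : Prop where
  of_lt_iff_lt : ∀ {β : Type} [Finite β] {x y : β → ℚ},
    (∀ i j, x i < x j ↔ y i < y j) → SameType L x y
  of_isRotation : ∀ {β : Type} [Finite β] {x y : β → ℚ} {t : ℚ},
    IsRotation (Set.Ici t) x y → SameType L x y
  neg : ∀ {β : Type} [Finite β] (x : β → ℚ), SameType L x (-x)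

/-- The order type of a tuple. -/
def orderCode {β : Type} (x : β → ℚ) : Set (β × β) := {p | x p.1 < x p.2}

theorem lt_iff_lt_of_orderCode_eq {β : Type} {x y : β → ℚ} (h : orderCode x = orderCode y)
    (i j : β) : x i < x j ↔ y i < y j :=
  Set.ext_iff.1 h (i, j)

namespace IsCircular

variable {L : FirstOrder.Language} [L.Structure ℚ]

theorem exists_extension (hL : IsCircular L) {α β : Type} [Finite α] [Finite β] (f : α → β)
    (x : β → ℚ) {y : α → ℚ} (h : SameType L (x ∘ f) y) :
    ∃ z : β → ℚ, z ∘ f = y ∧ SameType L x z :=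
  h.exists_extension orderCode (fun _ _ h => hL.of_lt_iff_lt (lt_iff_lt_of_orderCode_eq h)) f x

theorem definable_of_invariant (hL : IsCircular L) {α : Type} [Finite α] {S : Set (α → ℚ)}
    (hS : ∀ x y, SameType L x y → x ∈ S → y ∈ S) : (∅ : Set ℚ).Definable L S :=
  definable_of_sameType_invariant orderCode
    (fun _ _ h => hL.of_lt_iff_lt (lt_iff_lt_of_orderCode_eq h)) hS

end IsCircular

theorem cmp_eq_cmp_iff {a b c d : ℚ} : cmp a b = cmp c d ↔ (a < b ↔ c < d) ∧ (b < a ↔ d < c) := by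
  rcases lt_trichotomy a b with h | h | h <;> rcases lt_trichotomy c d with h' | h' | h' <;>
    simp [cmp, cmpUsing, h, h', h.not_gt, h'.not_gt]

/-- Formulas in an order-invariant relation are order-invariant. -/
theorem realize_iff_of_lt_iff_lt {n : ℕ} {Q : (Fin n → ℚ) → Prop}
    (hQ : ∀ x y : Fin n → ℚ, (∀ i j, x i < x j ↔ y i < y j) → (Q x ↔ Q y))
    {α : Type} [Finite α] (φ : (relLang n).Formula α) {v w : α → ℚ}
    (h : ∀ i j, v i < v j ↔ w i < w j) :
    letI : (relLang n).Structure ℚ := multiRelStructure (fun _ : Unit => Q)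
    (φ.Realize v ↔ φ.Realize w) := by
  let _ : (relLang n).Structure ℚ := multiRelStructure (fun _ : Unit => Q)
  change φ.Realize v ↔ φ.Realize w
  rw [Formula.Realize, Formula.Realize]
  refine realize_iff_of_backAndForth Q (fun β x y => ∀ i j, x i < x j ↔ y i < y j)
    (fun β x y h i j => (h i j).symm) (fun β γ f x y h i j => h _ _)
    (fun β x y h i j => (eq_iff_eq_of_lt_iff_lt h i j).1) hQ ?_ φ v w _ _ ?_
  · intro β _ x y h a
    classical
    cases nonempty_fintype β
    let f : Order.PartialIso ℚ ℚ := ⟨Finset.univ.image fun i => (x i, y i), by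
      intro p hp q hq
      obtain ⟨i, -, rfl⟩ := Finset.mem_image.1 hp
      obtain ⟨j, -, rfl⟩ := Finset.mem_image.1 hq
      exact cmp_eq_cmp_iff.2 ⟨h i j, h j i⟩⟩
    obtain ⟨b, hb⟩ := f.exists_across a
    have hb' : ∀ i, (x i < a ↔ y i < b) ∧ (a < x i ↔ b < y i) := fun i =>
      cmp_eq_cmp_iff.1 (hb (x i, y i) (Finset.mem_image_of_mem _ (Finset.mem_univ i)))
    refine ⟨b, ?_⟩
    rintro (_ | i) (_ | j)
    · simp
    · exact (hb' j).2
    · exact (hb' i).1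
    · exact h i j
  · rintro (i | i) (j | j)
    · exact h i j
    · exact j.elim0
    · exact i.elim0
    · exact i.elim0

/-- Formulas in `Q` are invariant under automorphisms of `Q`. -/
theorem realize_comp_iff_of_equiv {n : ℕ} {Q : (Fin n → ℚ) → Prop} (f : ℚ ≃ ℚ)
    (hQ : ∀ x, Q (f ∘ x) ↔ Q x) {α : Type} (φ : (relLang n).Formula α) (v : α → ℚ) :
    letI : (relLang n).Structure ℚ := multiRelStructure (fun _ : Unit => Q)
    (φ.Realize (f ∘ v) ↔ φ.Realize v) := by
  let _ : (relLang n).Structure ℚ := multiRelStructure (fun _ : Unit => Q)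
  let g : ℚ ≃[relLang n] ℚ :=
    { f with
      map_fun' := fun F => F.elim
      map_rel' := fun {m} r x => hQ fun j => x (Fin.cast r.2 j) }
  exact StrongHomClass.realize_formula g φ

/-- There is a bijection of `ℚ` that exchanges the two sides of an irrational cut. -/
theorem exists_rotation_equiv : ∃ f : ℚ ≃ ℚ, ∃ U : Set ℚ, IsUpperSet U ∧
    (∀ q ≤ 0, q ∉ U) ∧ (∀ q, 2 ≤ q → q ∈ U) ∧ IsRotation U id f := by
  classical
  let s : Set ℚ := {q | (q : ℝ) < √2}
  let U : Set ℚ := {q | √2 < (q : ℝ)}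
  have hsU : ∀ q, q ∉ U ↔ q ∈ s := fun q => by
    have : (q : ℝ) ≠ √2 := fun h => irrational_sqrt_two ⟨q, h⟩
    change ¬ √2 < (q : ℝ) ↔ (q : ℝ) < √2
    rw [not_lt]
    exact ⟨fun h => lt_of_le_of_ne h this, le_of_lt⟩
  have hsl : IsLowerSet s := fun a b hba ha =>
    lt_of_le_of_lt (show (b : ℝ) ≤ a by exact_mod_cast hba) ha
  have hs : s.OrdConnected := hsl.ordConnected
  have hUup : IsUpperSet U := fun a b hab ha =>
    lt_of_lt_of_le (show √2 < (a : ℝ) from ha) (by exact_mod_cast hab)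
  have hU : U.OrdConnected := hUup.ordConnected
  have h0 : ∀ q ≤ 0, q ∈ s := fun q hq =>
    lt_of_le_of_lt (by exact_mod_cast hq) (Real.sqrt_pos.2 two_pos)
  have h2 : ∀ q : ℚ, 2 ≤ q → q ∈ U := fun q hq => by
    have h1 : √2 < 2 := by
      rw [Real.sqrt_lt' two_pos]; norm_num
    exact lt_of_lt_of_le h1 (by exact_mod_cast hq)
  have : Nonempty s := ⟨⟨0, h0 0 le_rfl⟩⟩
  have : Nonempty U := ⟨⟨2, h2 2 le_rfl⟩⟩
  have : NoMinOrder s := ⟨fun a => ⟨⟨a - 1, hsl (by simp) a.2⟩, by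
    rw [← Subtype.coe_lt_coe]; simp⟩⟩
  have : NoMaxOrder U := ⟨fun a => ⟨⟨a + 1, hUup (by simp) a.2⟩, by
    rw [← Subtype.coe_lt_coe]; simp⟩⟩
  have : NoMaxOrder s := ⟨fun a => by
    obtain ⟨q, hq, hq'⟩ := exists_rat_btwn (show ((a : ℚ) : ℝ) < √2 from a.2)
    exact ⟨⟨q, hq'⟩, by rw [← Subtype.coe_lt_coe]; exact_mod_cast hq⟩⟩
  have : NoMinOrder U := ⟨fun a => by
    obtain ⟨q, hq, hq'⟩ := exists_rat_btwn (show √2 < ((a : ℚ) : ℝ) from a.2)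
    exact ⟨⟨q, hq⟩, by rw [← Subtype.coe_lt_coe]; exact_mod_cast hq'⟩⟩
  obtain ⟨e⟩ := Order.iso_of_countable_dense s U
  let f : ℚ → ℚ := fun q => if h : q ∈ U then e.symm ⟨q, h⟩ else e ⟨q, (hsU q).1 h⟩
  have fU : ∀ q (h : q ∈ U), f q = e.symm ⟨q, h⟩ := fun q h => dif_pos h
  have fs : ∀ q (h : q ∉ U), f q = e ⟨q, (hsU q).1 h⟩ := fun q h => dif_neg h
  have fmem : ∀ q, f q ∈ U ↔ q ∉ U := fun q => by
    by_cases h : q ∈ U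
    · rw [fU q h]
      simp only [h, not_true, iff_false]
      exact (hsU _).2 (e.symm ⟨q, h⟩).2
    · rw [fs q h]
      simp only [h, not_false_eq_true, iff_true]
      exact (e _).2
  have ff : Function.Involutive f := fun q => by
    by_cases h : q ∈ U
    · rw [fs (f q) (by rw [fmem]; exact not_not.2 h)]
      simp [fU q h]
    · rw [fU (f q) ((fmem q).2 h)]
      simp [fs q h]
  refine ⟨ff.toPerm f, U, hUup, fun q hq => (hsU q).2 (h0 q hq), h2, fun i j => ?_⟩
  have sep : ∀ a b, a ∉ U → b ∈ U → a < b := fun a b ha hb =>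
    lt_of_not_ge fun hba => ha (hUup hba hb)
  change f i < f j ↔ _
  simp only [id]
  by_cases hi : i ∈ U <;> by_cases hj : j ∈ U
  · simp only [hi, hj, not_true, and_false, false_or, iff_self, and_true]
    rw [fU i hi, fU j hj, Subtype.coe_lt_coe, e.symm.lt_iff_lt, ← Subtype.coe_lt_coe]
  · simp only [hi, hj, not_false_eq_true, and_self, true_or, iff_true]
    exact sep _ _ (by rw [fmem]; exact not_not.2 hi) ((fmem j).2 hj)
  · simp only [hi, hj, false_and, iff_true, and_false, or_self, iff_false]
    exact (sep _ _ (by rw [fmem]; exact not_not.2 hj) ((fmem i).2 hi)).le.not_gt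
  · simp only [hi, hj, false_and, false_or, iff_self, and_true]
    rw [fs i hi, fs j hj, Subtype.coe_lt_coe, e.lt_iff_lt, ← Subtype.coe_lt_coe]

theorem sameType_of_realize_iff {L : FirstOrder.Language} {M : Type} [L.Structure M] {α : Type}
    {x y : α → M} (h : ∀ φ : L.Formula α, φ.Realize x ↔ φ.Realize y) : SameType L x y := by
  intro S hS
  obtain ⟨φ, rfl⟩ := Set.empty_definable_iff.1 hS
  exact h φ

/-- A relation definable from both `b` and `c` has circular types. -/
theorem isCircular_of_definableBy {n : ℕ} {R : (Fin n → ℚ) → Prop}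
    (hb : DefinableBy bRel R) (hc : DefinableBy cRel R) :
    letI : (relLang n).Structure ℚ := multiRelStructure (fun _ : Unit => R)
    IsCircular (relLang n) := by
  let _ : (relLang n).Structure ℚ := multiRelStructure (fun _ : Unit => R)
  obtain ⟨φ, hφ⟩ := hb
  obtain ⟨ψ, hψ⟩ := hc
  have hR : ∀ x y : Fin n → ℚ, (∀ i j, x i < x j ↔ y i < y j) → (R x ↔ R y) := by
    intro x y h
    rw [hφ, hφ]
    exact realize_iff_of_lt_iff_lt (fun x y h => by simp [bRel, h]) φ h
  have hord : ∀ {β : Type} [Finite β] {x y : β → ℚ},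
      (∀ i j, x i < x j ↔ y i < y j) → SameType (relLang n) x y := fun h =>
    sameType_of_realize_iff fun φ => realize_iff_of_lt_iff_lt hR φ h
  refine ⟨hord, ?_, ?_⟩
  · intro β _ x y t h
    obtain ⟨f, U, hU, h0, h2, hf⟩ := exists_rotation_equiv
    have hRf : ∀ v, R (f ∘ v) ↔ R v := fun v => by
      rw [hψ, hψ]
      exact realize_comp_iff_of_equiv f (fun w => hf.cRel_iff hU (w 0) (w 1) (w 2)) ψ v
    let K : ℚ := |t| + 2
    let v : β → ℚ := fun i => if t ≤ x i then x i + K else x i - K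
    have hK : t ≤ K ∧ -K ≤ t - 2 ∧ 0 < K := by
      have h1 := le_abs_self t
      have h2 := neg_abs_le t
      refine ⟨?_, ?_, ?_⟩ <;> simp only [K] <;> linarith [abs_nonneg t]
    have hvU : ∀ i, v i ∈ U ↔ t ≤ x i := fun i => by
      by_cases hi : t ≤ x i
      · simp only [v, hi, if_true, iff_true]
        exact h2 _ (by linarith)
      · simp only [v, hi, if_false, iff_false]
        exact h0 _ (by linarith)
    have hxv : ∀ i j, x i < x j ↔ v i < v j := fun i j => by
      simp only [v]
      split_ifs <;> constructor <;> intro _ <;> linarith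
    have h1 : SameType (relLang n) x v := hord hxv
    have h3 : SameType (relLang n) v (f ∘ v) :=
      sameType_of_realize_iff fun φ => (realize_comp_iff_of_equiv f hRf φ v).symm
    have h4 : SameType (relLang n) (f ∘ v) y := hord fun i j => by
      rw [h i j, Function.comp, Function.comp, hf (v i) (v j)]
      simp only [id, hvU, ← hxv, Set.mem_Ici]
    exact (h1.trans h3).trans h4
  · intro β _ x
    have hRf : ∀ v, R (Equiv.neg ℚ ∘ v) ↔ R v := fun v => by
      rw [hφ, hφ]
      refine realize_comp_iff_of_equiv (Equiv.neg ℚ) (fun w => ?_) φ v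
      simp only [bRel, Function.comp, Equiv.neg_apply, neg_lt_neg_iff]
      tauto
    exact sameType_of_realize_iff fun φ => (realize_comp_iff_of_equiv _ hRf φ x).symm

/-! The separation relation determines types. -/

theorem lt_of_betweenness_iff {x₀ x₁ x₂ x₃ y₀ y₁ y₂ y₃ : ℚ}
    (h : ∀ i j k : Fin 4, bRel ![![x₀, x₁, x₂, x₃] i, ![x₀, x₁, x₂, x₃] j, ![x₀, x₁, x₂, x₃] k] ↔
      bRel ![![y₀, y₁, y₂, y₃] i, ![y₀, y₁, y₂, y₃] j, ![y₀, y₁, y₂, y₃] k])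
    (heq : ∀ i j : Fin 4, ![x₀, x₁, x₂, x₃] i = ![x₀, x₁, x₂, x₃] j ↔
      ![y₀, y₁, y₂, y₃] i = ![y₀, y₁, y₂, y₃] j)
    (hx : x₀ < x₁) (hy : y₀ < y₁) (hij : x₂ < x₃) : y₂ < y₃ := by
  have h1 := h 0 1 2
  have h2 := h 1 0 2
  have h3 := h 0 2 1
  have h4 := h 0 1 3
  have h5 := h 1 0 3
  have h6 := h 0 3 1
  have h7 := h 0 2 3
  have h8 := h 0 3 2
  have h9 := h 2 0 3
  have h10 := h 1 2 3
  have h11 := h 1 3 2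
  have h12 := h 2 1 3
  have e1 := heq 0 1
  have e2 := heq 0 2
  have e3 := heq 0 3
  have e4 := heq 1 2
  have e5 := heq 1 3
  have e6 := heq 2 3
  clear h heq
  simp only [bRel, Matrix.cons_val] at *
  grind

theorem sRel_iff_bRel_of_min {a b c d : ℚ} (hb : a < b) (hc : a < c) (hd : a < d) :
    sRel ![a, b, c, d] ↔ bRel ![b, c, d] := by
  simp only [sRel, cRel, bRel, Matrix.cons_val]
  grind

theorem lt_iff_lt_of_bRel_iff {β : Type} {x y : β → ℚ} {o p q : β}
    (hxo : ∀ i, x o ≤ x i) (hyo : ∀ i, y o ≤ y i) (heq : ∀ i j, x i = x j ↔ y i = y j)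
    (hb : ∀ i j k, x o < x i → x o < x j → x o < x k →
      (bRel ![x i, x j, x k] ↔ bRel ![y i, y j, y k]))
    (hp : x o < x p) (hx : x p < x q) (hy : y p < y q) (i j : β) : x i < x j ↔ y i < y j := by
  have hpos : ∀ i, x o < x i ↔ y o < y i := fun i => by
    rw [lt_iff_le_and_ne, lt_iff_le_and_ne, Ne, Ne, heq]
    simp [hxo, hyo]
  have forward : ∀ {i j}, x o < x i → x o < x j → (x i < x j ↔ y i < y j) := by
    intro i j hi hj
    have hpos' : ∀ m : Fin 4, x o < x (![p, q, i, j] m) := by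
      intro m
      fin_cases m
      exacts [hp, hp.trans hx, hi, hj]
    have hxm : ∀ m, ![x p, x q, x i, x j] m = x (![p, q, i, j] m) := by
      intro m; fin_cases m <;> rfl
    have hym : ∀ m, ![y p, y q, y i, y j] m = y (![p, q, i, j] m) := by
      intro m; fin_cases m <;> rfl
    constructor
    · refine lt_of_betweenness_iff (fun a b c => ?_) (fun a b => ?_) hx hy
      · simp only [hxm, hym]
        exact hb _ _ _ (hpos' a) (hpos' b) (hpos' c)
      · simp only [hxm, hym, heq]
    · refine lt_of_betweenness_iff (fun a b c => ?_) (fun a b => ?_) hy hx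
      · simp only [hxm, hym]
        exact (hb _ _ _ (hpos' a) (hpos' b) (hpos' c)).symm
      · simp only [hxm, hym, heq]
  rcases (hxo i).lt_or_eq with hi | hi
  · rcases (hxo j).lt_or_eq with hj | hj
    · exact forward hi hj
    · rw [← hj, ← (heq o j).1 hj]
      exact iff_of_false (hxo i).not_gt (hyo i).not_gt
  · rw [← hi, ← (heq o i).1 hi]
    exact hpos j

theorem IsRotation.isMin {β : Type} {x u : β → ℚ} {o : β}
    (h : IsRotation (Set.Ici (x o)) x u) (i : β) : u o ≤ u i := by
  rw [← not_lt, h i o]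
  simp only [Set.mem_Ici, le_refl, not_true, and_false, iff_true, false_or, not_and]
  exact fun hi => hi.not_ge

theorem IsRotation.apply_eq_iff {U : Set ℚ} {β : Type} {x u : β → ℚ}
    (h : IsRotation U x u) (i j : β) : x i = x j ↔ u i = u j := by
  have h1 := h i j
  have h2 := h j i
  constructor
  · intro hij
    rw [hij] at h1 h2
    grind
  · grind

theorem IsRotation.neg_lt_neg_iff {β : Type} {y u : β → ℚ} {o : β}
    (h : IsRotation (Set.Ici ((-y) o)) (-y) u) {i j : β} (hi : y o < y i) (hj : y o < y j) :
    u i < u j ↔ y j < y i := by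
  rw [h i j]
  simp only [Set.mem_Ici, Pi.neg_apply, _root_.neg_lt_neg_iff, neg_le_neg_iff, hi.not_ge,
    hj.not_ge, false_and, false_or, and_true]

namespace IsCircular

variable {L : FirstOrder.Language} [L.Structure ℚ]

theorem sameType_of_sRel_iff_of_min (hL : IsCircular L) {β : Type} [Finite β] {x y : β → ℚ}
    {o : β} (hxo : ∀ i, x o ≤ x i) (hyo : ∀ i, y o ≤ y i) (heq : ∀ i j, x i = x j ↔ y i = y j)
    (hs : ∀ i j k l, sRel ![x i, x j, x k, x l] ↔ sRel ![y i, y j, y k, y l]) :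
    SameType L x y := by
  have hpos : ∀ i, x o < x i → y o < y i := fun i hi =>
    lt_of_le_of_ne (hyo i) fun h => hi.ne ((heq o i).2 h)
  have hb : ∀ i j k, x o < x i → x o < x j → x o < x k →
      (bRel ![x i, x j, x k] ↔ bRel ![y i, y j, y k]) := fun i j k hi hj hk => by
    rw [← sRel_iff_bRel_of_min hi hj hk, hs,
      sRel_iff_bRel_of_min (hpos i hi) (hpos j hj) (hpos k hk)]
  by_cases hpq : ∃ p q, x o < x p ∧ x p < x q
  · obtain ⟨p, q, hp, hx⟩ := hpq
    have hq := hp.trans hx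
    rcases lt_or_gt_of_ne (fun h => hx.ne ((heq p q).2 h)) with hy | hy
    · exact hL.of_lt_iff_lt (lt_iff_lt_of_bRel_iff hxo hyo heq hb hp hx hy)
    · obtain ⟨u, hu⟩ := exists_isRotation_Ici ((-y) o) (-y)
      refine SameType.trans ?_ ((hL.neg y).trans (hL.of_isRotation hu)).symm
      have hlt : ∀ {i j}, x o < x i → x o < x j → (u i < u j ↔ y j < y i) := fun hi hj =>
        hu.neg_lt_neg_iff (hpos _ hi) (hpos _ hj)
      refine hL.of_lt_iff_lt (lt_iff_lt_of_bRel_iff hxo hu.isMin (fun i j => ?_)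
        (fun i j k hi hj hk => ?_) hp hx ((hlt hp hq).2 hy))
      · rw [heq, ← hu.apply_eq_iff]
        simp
      · rw [hb i j k hi hj hk]
        simp only [bRel, Matrix.cons_val, hlt hi hj, hlt hj hk, hlt hj hi, hlt hk hj]
        tauto
  · push Not at hpq
    refine hL.of_lt_iff_lt fun i j => ?_
    rcases (hxo i).lt_or_eq with hi | hi
    · have hx : ¬ x i < x j := (hpq i j hi).not_gt
      have hy : ¬ y i < y j := by
        rcases (hxo j).lt_or_eq with hj | hj
        · rw [(heq i j).1 (le_antisymm (hpq j i hj) (hpq i j hi))]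
          exact lt_irrefl _
        · rw [← (heq o j).1 hj]
          exact (hyo i).not_gt
      exact iff_of_false hx hy
    · rw [← hi, ← (heq o i).1 hi]
      refine ⟨hpos j, fun h => lt_of_le_of_ne (hxo j) fun hj => h.ne ((heq o j).1 hj)⟩

theorem sameType_of_sRel_iff (hL : IsCircular L) {β : Type} [Finite β] {x y : β → ℚ}
    (heq : ∀ i j, x i = x j ↔ y i = y j)
    (hs : ∀ i j k l, sRel ![x i, x j, x k, x l] ↔ sRel ![y i, y j, y k, y l]) :
    SameType L x y := by
  rcases isEmpty_or_nonempty β with hβ | ⟨⟨o⟩⟩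
  · exact hL.of_lt_iff_lt fun i => hβ.elim i
  · obtain ⟨u, hu⟩ := exists_isRotation_Ici (x o) x
    obtain ⟨v, hv⟩ := exists_isRotation_Ici (y o) y
    refine ((hL.of_isRotation hu).trans ?_).trans (hL.of_isRotation hv).symm
    refine hL.sameType_of_sRel_iff_of_min hu.isMin hv.isMin (fun i j => ?_) fun i j k l => ?_
    · rw [← hu.apply_eq_iff, heq, hv.apply_eq_iff]
    · have h := hs i j k l
      simp only [sRel, Matrix.cons_val] at h ⊢
      simp only [hu.cRel_iff (isUpperSet_Ici _), hv.cRel_iff (isUpperSet_Ici _), h]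

end IsCircular

/-! If types do not determine the separation relation, all injective tuples have the same type. -/

theorem injective_of_sRel {x : Fin 4 → ℚ} (h : sRel x) : Function.Injective x := by
  simp only [sRel, cRel, Matrix.cons_val] at h
  have : x 0 ≠ x 1 ∧ x 0 ≠ x 2 ∧ x 0 ≠ x 3 ∧ x 1 ≠ x 2 ∧ x 1 ≠ x 3 ∧ x 2 ≠ x 3 := by grind
  intro i j hij
  fin_cases i <;> fin_cases j <;> simp_all

/-- The indices in `Fin (n + 1)`, rotated so that `i` and `i + 1` become the greatest ones, as
indices of two points above an increasing sequence. -/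
def rotatedIndex {n : ℕ} (i : Fin n) (k : Fin (n + 1)) : Fin 2 ⊕ Fin (2 * n + 2) :=
  if k = i.castSucc then Sum.inl 0
  else if k = i.succ then Sum.inl 1
  else Sum.inr ⟨if k ≤ i.succ then k + (n + 1) else k, by split_ifs <;> omega⟩

theorem isRotation_rotatedIndex {n : ℕ} (i : Fin n) {w : Fin (2 * n + 2) → ℚ} (hw : StrictMono w)
    {a b : ℚ} (hab : a < b) (hwa : ∀ k, w k < a) :
    IsRotation (Set.Ici ((i : ℚ) + 2)) (fun k : Fin (n + 1) => (k : ℚ))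
      (Sum.elim ![a, b] w ∘ rotatedIndex i) := by
  intro k l
  have hwb : ∀ k, w k < b := fun k => (hwa k).trans hab
  have hk : (i : ℚ) + 2 ≤ k ↔ (i : ℕ) + 2 ≤ k := by exact_mod_cast Iff.rfl
  have hl : (i : ℚ) + 2 ≤ l ↔ (i : ℕ) + 2 ≤ l := by exact_mod_cast Iff.rfl
  have hw' : ∀ p q, w p < w q ↔ (p : ℕ) < q := fun p q => hw.lt_iff_lt
  simp only [Set.mem_Ici, hk, hl, Nat.cast_lt, Function.comp, rotatedIndex, Fin.ext_iff,
    Fin.val_castSucc, Fin.val_succ, Fin.le_def]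
  by_cases hki : (k : ℕ) = i <;> by_cases hki' : (k : ℕ) = i + 1 <;>
    by_cases hli : (l : ℕ) = i <;> by_cases hli' : (l : ℕ) = i + 1 <;>
    simp only [hki, hki', hli, hli', if_true, if_false, Sum.elim_inl, Sum.elim_inr,
      Matrix.cons_val, Nat.succ_ne_self, hw', hab, hwa, hwb, (hwa _).not_gt, (hwb _).not_gt,
      hab.not_gt, lt_self_iff_false, true_iff, false_iff] <;>
    grind

theorem rotatedIndex_swap {n : ℕ} (i : Fin n) (a b : ℚ) (w : Fin (2 * n + 2) → ℚ) :
    (Sum.elim ![a, b] w ∘ rotatedIndex i) ∘ Equiv.swap i.castSucc i.succ =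
      Sum.elim ![b, a] w ∘ rotatedIndex i := by
  have hne : i.succ ≠ i.castSucc := i.castSucc_lt_succ.ne'
  funext k
  by_cases h1 : k = i.castSucc
  · subst h1
    simp [rotatedIndex, hne]
  by_cases h2 : k = i.succ
  · subst h2
    simp [rotatedIndex, hne]
  · simp [rotatedIndex, Equiv.swap_apply_of_ne_of_ne h1 h2, h1, h2]

namespace IsCircular

variable {L : FirstOrder.Language} [L.Structure ℚ]

/-- If the separation relation is not a union of types, then types do not see the order of two
points above an increasing sequence. -/
theorem exists_sameType_reversed (hL : IsCircular L) {x y : Fin 4 → ℚ} (hxy : SameType L x y)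
    (hx : sRel x) (hy : ¬ sRel y) (m : ℕ) :
    ∃ (w : Fin (m + 1) → ℚ) (a b c d : ℚ), StrictMono w ∧ (∀ k, w k < a) ∧ (∀ k, w k < d) ∧
      a < b ∧ d < c ∧ SameType L (Sum.elim ![a, b] w) (Sum.elim ![c, d] w) := by
  classical
  have hxinj := injective_of_sRel hx
  obtain ⟨B, hB⟩ := (Set.finite_range x).bddBelow
  have hB : ∀ i, B ≤ x i := fun i => hB (Set.mem_range_self i)
  let N := Fintype.card (Finset (Fin 4)) * (m + 1)
  let z : Fin N → ℚ := fun k => B - 1 - k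
  have hz : ∀ k i, z k < x i := fun k i => by
    have h1 := hB i
    have h2 : (0 : ℚ) ≤ (k : ℕ) := Nat.cast_nonneg _
    simp only [z]
    linarith
  have hzinj : Function.Injective z := fun k l h => by
    simp only [z, sub_right_inj, Nat.cast_inj] at h
    exact Fin.ext h
  have hXinj : Function.Injective (Sum.elim x z) :=
    hxinj.sumElim hzinj fun i k => (hz k i).ne'
  obtain ⟨Z, hZy, hXZ⟩ := hL.exists_extension Sum.inl (Sum.elim x z) hxy
  have hZinj : Function.Injective Z := fun i j h => hXinj ((hXZ.apply_eq_iff i j).2 h)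
  have hZy : ∀ i, Z (Sum.inl i) = y i := fun i => congrFun hZy i
  -- by the pigeonhole principle, `m + 1` of the new points lie between the same two of the `y i`
  obtain ⟨C, hC⟩ := Fintype.exists_le_card_fiber_of_mul_le_card (n := m + 1)
    (fun k : Fin N => Finset.univ.filter fun i => y i < Z (Sum.inr k)) (by simp [N])
  set F := Finset.univ.filter fun k : Fin N =>
    (Finset.univ.filter fun i => y i < Z (Sum.inr k)) = C
  have hcard : m + 1 ≤ (F.image (Z ∘ Sum.inr)).card := by
    rwa [Finset.card_image_of_injective _ (hZinj.comp Sum.inr_injective)]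
  let ε := (F.image (Z ∘ Sum.inr)).orderEmbOfCardLe hcard
  have hε : ∀ k, ∃ l ∈ F, Z (Sum.inr l) = ε k := fun k =>
    Finset.mem_image.1 (Finset.orderEmbOfCardLe_mem _ hcard k)
  choose e heF he using hε
  have heC : ∀ k i, y i < Z (Sum.inr (e k)) ↔ i ∈ C := fun k i => by
    have := (Finset.mem_filter.1 (heF k)).2
    rw [← this]
    simp
  obtain ⟨u, hu⟩ := exists_isRotation_Ici (Z (Sum.inr (e 0))) (Z ∘ Sum.map id e)
  have hXu : SameType L (Sum.elim x z ∘ Sum.map id e) u :=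
    (hXZ.comp _).trans (hL.of_isRotation hu)
  have hmem : ∀ k, Z (Sum.inr (e 0)) ≤ Z (Sum.inr (e k)) := fun k => by
    rw [he, he]
    exact ε.monotone (Fin.zero_le k)
  have hwmono : StrictMono (u ∘ Sum.inr) := fun k l hkl => by
    refine (hu _ _).2 (Or.inr ⟨?_, ?_⟩)
    · simp only [Function.comp, Sum.map_inr, he]
      exact ε.strictMono hkl
    · simp [hmem]
  have hwu : ∀ k i, u (Sum.inr k) < u (Sum.inl i) := fun k i => by
    refine (hu _ _).2 ?_
    simp only [Function.comp, Sum.map_inr, Sum.map_inl, id, hZy, Set.mem_Ici, hmem, true_and,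
      true_iff]
    by_cases h : i ∈ C
    · exact Or.inl (not_le.2 ((heC 0 i).2 h))
    · have hle : ∀ k, Z (Sum.inr (e k)) ≤ y i := fun k => not_lt.1 (mt (heC k i).1 h)
      refine Or.inr ⟨lt_of_le_of_ne (hle k) fun h' => ?_, hle 0⟩
      rw [← hZy] at h'
      exact Sum.inr_ne_inl (hZinj h')
  have hsu : ¬ sRel (u ∘ Sum.inl) := by
    rw [IsRotation.sRel_iff (isUpperSet_Ici (Z (Sum.inr (e 0)))) (v := y)]
    · exact hy
    · intro i j
      have h := hu (Sum.inl i) (Sum.inl j)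
      simp only [Function.comp, Sum.map_inl, id, hZy] at h
      exact h
  have hune : ∀ i j, x i < x j → u (Sum.inl i) ≠ u (Sum.inl j) := fun i j hij h =>
    hij.ne ((hXu.apply_eq_iff (Sum.inl i) (Sum.inl j)).2 h)
  obtain ⟨a, b, hab, huab⟩ : ∃ a b, x a < x b ∧ u (Sum.inl a) < u (Sum.inl b) := by
    by_contra! hcon
    refine hsu ((sRel_iff_of_lt_iff_gt fun i j => ?_).2 hx)
    simp only [Function.comp]
    rcases lt_trichotomy (x i) (x j) with h | h | h
    · exact iff_of_false (hcon i j h).not_gt h.not_gt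
    · rw [hxinj h]; simp
    · exact iff_of_true (lt_of_le_of_ne (hcon j i h) (hune j i h).symm) h
  obtain ⟨c, d, hcd, hucd⟩ : ∃ c d, x c < x d ∧ u (Sum.inl d) < u (Sum.inl c) := by
    by_contra! hcon
    refine hsu ((sRel_iff_of_lt_iff_lt fun i j => ?_).2 hx)
    simp only [Function.comp]
    rcases lt_trichotomy (x i) (x j) with h | h | h
    · exact iff_of_true (lt_of_le_of_ne (hcon i j h) (hune i j h)) h
    · rw [hxinj h]; simp
    · exact iff_of_false (hcon j i h).not_gt h.not_gt
  refine ⟨u ∘ Sum.inr, u (Sum.inl a), u (Sum.inl b), u (Sum.inl c), u (Sum.inl d), hwmono,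
    fun k => hwu k a, fun k => hwu k d, huab, hucd, ?_⟩
  have hpair : ∀ p q : Fin 4, SameType L (Sum.elim ![x p, x q] (z ∘ e))
      (Sum.elim ![u (Sum.inl p), u (Sum.inl q)] (u ∘ Sum.inr)) := fun p q => by
    have h := hXu.comp (Sum.map ![p, q] id : Fin 2 ⊕ Fin (m + 1) → Fin 4 ⊕ Fin (m + 1))
    convert h using 1 <;> funext i <;> rcases i with i | i
    · fin_cases i <;> rfl
    · rfl
    · fin_cases i <;> rfl
    · rfl
  refine ((hpair a b).symm.trans (hL.of_lt_iff_lt fun i j => ?_)).trans (hpair c d)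
  rcases i with i | i <;> rcases j with j | j
  · fin_cases i <;> fin_cases j <;> simp [hab, hcd, hab.not_gt, hcd.not_gt]
  · fin_cases i <;> simp [fun k i => (hz k i).not_gt]
  · fin_cases j <;> simp [hz]
  · simp

theorem sameType_swap (hL : IsCircular L) {x y : Fin 4 → ℚ} (hxy : SameType L x y)
    (hx : sRel x) (hy : ¬ sRel y) {n : ℕ} (i : Fin n) :
    SameType L (fun k : Fin (n + 1) => (k : ℚ))
      ((fun k : Fin (n + 1) => (k : ℚ)) ∘ Equiv.swap i.castSucc i.succ) := by
  obtain ⟨w, a, b, c, d, hw, ha, hd, hab, hdc, h⟩ :=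
    hL.exists_sameType_reversed hxy hx hy (2 * n + 1)
  have h1 := hL.of_isRotation (isRotation_rotatedIndex i hw hab ha)
  have h2 := (hL.of_isRotation (isRotation_rotatedIndex i hw hdc hd)).comp
    (Equiv.swap i.castSucc i.succ)
  rw [rotatedIndex_swap] at h2
  exact (h1.trans (h.comp _)).trans h2.symm

theorem sameType_perm (hL : IsCircular L) {x y : Fin 4 → ℚ} (hxy : SameType L x y)
    (hx : sRel x) (hy : ¬ sRel y) {n : ℕ} (σ : Equiv.Perm (Fin n)) :
    SameType L (fun k : Fin n => (k : ℚ)) ((fun k : Fin n => (k : ℚ)) ∘ σ) := by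
  cases n with
  | zero => exact hL.of_lt_iff_lt fun i => i.elim0
  | succ n =>
    let G : Submonoid (Equiv.Perm (Fin (n + 1))) :=
      { carrier := {σ | SameType L (fun k : Fin (n + 1) => (k : ℚ))
          ((fun k : Fin (n + 1) => (k : ℚ)) ∘ σ)}
        one_mem' := SameType.rfl
        mul_mem' := fun {σ τ} hσ hτ => SameType.trans hτ (SameType.comp hσ τ) }
    have hG : Submonoid.closure (Set.range fun i : Fin n => Equiv.swap i.castSucc i.succ) ≤ G := by
      rw [Submonoid.closure_le]
      rintro _ ⟨i, rfl⟩
      exact hL.sameType_swap hxy hx hy i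
    rw [Equiv.Perm.mclosure_swap_castSucc_succ] at hG
    exact hG (Submonoid.mem_top σ)

theorem sameType_of_injective (hL : IsCircular L) {x y : Fin 4 → ℚ} (hxy : SameType L x y)
    (hx : sRel x) (hy : ¬ sRel y) {β : Type} [Finite β] {u v : β → ℚ}
    (hu : Function.Injective u) (hv : Function.Injective v) : SameType L u v := by
  obtain ⟨n, ⟨e⟩⟩ := Finite.exists_equiv_fin β
  have key : ∀ w : β → ℚ, Function.Injective w →
      SameType L (fun k : Fin n => (k : ℚ)) (w ∘ e.symm) := by
    intro w hw
    let τ := Tuple.sort (w ∘ e.symm)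
    have hmono : StrictMono ((w ∘ e.symm) ∘ τ) :=
      (Tuple.monotone_sort _).strictMono_of_injective
        ((hw.comp e.symm.injective).comp τ.injective)
    have h : SameType L (fun k : Fin n => (k : ℚ)) ((w ∘ e.symm) ∘ τ) :=
      hL.of_lt_iff_lt fun i j => by rw [hmono.lt_iff_lt, Nat.cast_lt, Fin.lt_def]
    rw [← SameType.comp_equiv_iff τ]
    exact (hL.sameType_perm hxy hx hy τ).symm.trans h
  rw [← SameType.comp_equiv_iff e.symm]
  exact (key u hu).symm.trans (key v hv)

theorem sameType_of_apply_eq_iff (hL : IsCircular L) {x y : Fin 4 → ℚ} (hxy : SameType L x y)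
    (hx : sRel x) (hy : ¬ sRel y) {β : Type} [Finite β] {u v : β → ℚ}
    (huv : ∀ i j, u i = u j ↔ v i = v j) : SameType L u v := by
  have hv : ∀ i j, Setoid.ker u i j → v i = v j := fun i j h => (huv i j).1 h
  have h : SameType L (Quotient.lift u fun _ _ h => h : Quotient (Setoid.ker u) → ℚ)
      (Quotient.lift v hv) := by
    refine hL.sameType_of_injective hxy hx hy ?_ ?_
    · rintro ⟨i⟩ ⟨j⟩ h
      exact Quotient.sound h
    · rintro ⟨i⟩ ⟨j⟩ h
      exact Quotient.sound ((huv i j).2 h)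
  exact h.comp (Quotient.mk (Setoid.ker u))

end IsCircular

/-! Conclusion. -/

theorem definableBy_iff {M : Type} {n k : ℕ} {Q : (Fin n → M) → Prop} {R : (Fin k → M) → Prop} :
    letI : (relLang n).Structure M := multiRelStructure (fun _ : Unit => Q)
    DefinableBy Q R ↔ (∅ : Set M).Definable (relLang n) {v | R v} := by
  let _ : (relLang n).Structure M := multiRelStructure (fun _ : Unit => Q)
  refine Iff.trans ?_ Set.empty_definable_iff.symm
  exact exists_congr fun φ => Set.ext_iff.symm

theorem DefinableBy.refl {M : Type} {n : ℕ} (R : (Fin n → M) → Prop) : DefinableBy R R := by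
  let _ : (relLang n).Structure M := multiRelStructure (fun _ : Unit => R)
  exact ⟨Relations.formula (L := relLang n) (n := n) ⟨(), rfl⟩ fun i => Term.var i,
    fun _ => Iff.rfl⟩

/-- If an `n`-ary relation `R` on `ℚ` is definable both from the betweenness relation `b`
alone and from the cyclic order relation `c` alone, then either `R` and the separation
relation `s` define each other, or `R` is definable in the pure language of equality. -/
theorem definable_from_b_and_c {n : ℕ} (R : (Fin n → ℚ) → Prop)
    (hb : DefinableBy bRel R) (hc : DefinableBy cRel R) :
    (DefinableBy sRel R ∧ DefinableBy R sRel) ∨ EqDefinable R := by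
  let _ : (relLang n).Structure ℚ := multiRelStructure (fun _ : Unit => R)
  have hL : IsCircular (relLang n) := isCircular_of_definableBy hb hc
  have hR : ∀ x y, SameType (relLang n) x y → R x → R y := fun x y h =>
    (h _ (definableBy_iff.1 (DefinableBy.refl R))).1
  by_cases h : ∀ x y : Fin 4 → ℚ, SameType (relLang n) x y → sRel x → sRel y
  · refine Or.inl ⟨?_, definableBy_iff.2 (hL.definable_of_invariant h)⟩
    have hinv : ∀ x y : Fin n → ℚ, (∀ i j, x i = x j ↔ y i = y j) →
        (∀ i j k l, sRel ![x i, x j, x k, x l] ↔ sRel ![y i, y j, y k, y l]) → R x → R y :=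
      fun x y heq hs => hR x y (hL.sameType_of_sRel_iff heq hs)
    clear hL h hR
    rw [definableBy_iff]
    let _ : (relLang 4).Structure ℚ := multiRelStructure (fun _ : Unit => sRel)
    let D : (Fin n × Fin n) ⊕ (Fin 4 → Fin n) → Set (Fin n → ℚ) :=
      Sum.elim (fun p => {v | v p.1 = v p.2}) (fun f => {v | sRel (v ∘ f)})
    refine definable_of_finite_family D ?_ fun x y hxy => ?_
    · rintro (p | f)
      · exact definable_setOf_eq _ _ _
      · exact (definableBy_iff.1 (DefinableBy.refl sRel)).preimage_comp f
    · exact hinv x y (fun i j => hxy (Sum.inl (i, j)))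
        fun i j k l => hxy (Sum.inr ![i, j, k, l])
  · push Not at h
    obtain ⟨x, y, hxy, hx, hy⟩ := h
    have hinv : ∀ u v : Fin n → ℚ, (∀ i j, u i = u j ↔ v i = v j) → R u → R v :=
      fun u v huv => hR u v (hL.sameType_of_apply_eq_iff hxy hx hy huv)
    right
    let _ : Language.empty.Structure ℚ := Language.emptyStructure
    have hdef : (∅ : Set ℚ).Definable Language.empty {v | R v} :=
      definable_of_finite_family (fun p : Fin n × Fin n => {v | v p.1 = v p.2})
        (fun p => definable_setOf_eq _ _ _) fun u v huv => hinv u v fun i j => huv (i, j)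
    obtain ⟨φ, hφ⟩ := Set.empty_definable_iff.1 hdef
    exact ⟨φ, fun v => Set.ext_iff.1 hφ v⟩
end
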